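/- Let q ∈ [12/13, 1) and consider λ_q(x) = (1 - (1-x)^{1/2}) / ( 1 - (1-q)·(1 - 3x + 2·(1 - (1-x)^{3/2})) )², i.e., the check-regular variable degree distribution with k = 3. Then λ_q is real-analytic in a neighborhood of 0 and all of its Taylor coefficients at 0 are nonnegative (so λ_q(x) = Σ_{i≥1} λ_i x^{i-1} is a valid degree distribution with λ_i ≥ 0 for all i). -/

import Mathlib

open Filter Topology

/-- A real function that is analytic at `0` and whose Taylor coefficients there are nonnegative. -/
def HasNonnegTaylor (f : ℝ → ℝ) : Prop :=
  AnalyticAt ℝ f 0 ∧ ∀ n : ℕ, 0 ≤ iteratedDeriv n f 0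

namespace HasNonnegTaylor

variable {f g : ℝ → ℝ}

theorem congr (hf : HasNonnegTaylor f) (h : f =ᶠ[𝓝 0] g) : HasNonnegTaylor g :=
  ⟨hf.1.congr h, fun n => h.iteratedDeriv_eq n ▸ hf.2 n⟩

theorem add (hf : HasNonnegTaylor f) (hg : HasNonnegTaylor g) : HasNonnegTaylor (f + g) := by
  refine ⟨hf.1.add hg.1, fun n => ?_⟩
  rw [iteratedDeriv_add hf.1.contDiffAt hg.1.contDiffAt]
  exact add_nonneg (hf.2 n) (hg.2 n)

theorem mul (hf : HasNonnegTaylor f) (hg : HasNonnegTaylor g) : HasNonnegTaylor (f * g) := by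
  refine ⟨hf.1.mul hg.1, fun n => ?_⟩
  rw [iteratedDeriv_mul hf.1.contDiffAt hg.1.contDiffAt]
  exact Finset.sum_nonneg fun i _ =>
    mul_nonneg (mul_nonneg (Nat.cast_nonneg _) (hf.2 _)) (hg.2 _)

theorem const {c : ℝ} (hc : 0 ≤ c) : HasNonnegTaylor (fun _ => c) := by
  refine ⟨analyticAt_const, fun n => ?_⟩
  rw [iteratedDeriv_const]
  split_ifs <;> simp [hc]

theorem inv_one_sub (hf : HasNonnegTaylor f) (h0 : f 0 = 0) :
    HasNonnegTaylor (fun x => (1 - f x)⁻¹) := by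
  have han : AnalyticAt ℝ (fun x => (1 - f x)⁻¹) 0 :=
    (analyticAt_const.sub hf.1).inv (by simp [h0])
  have heq : (fun x => (1 - f x)⁻¹) =ᶠ[𝓝 0]
      (fun _ => (1 : ℝ)) + f * (fun x => (1 - f x)⁻¹) := by
    have hne : ∀ᶠ x in 𝓝 0, 1 - f x ≠ 0 :=
      (continuousAt_const.sub hf.1.continuousAt).eventually_ne (by simp [h0])
    filter_upwards [hne] with x hx
    simp only [Pi.add_apply, Pi.mul_apply]
    field_simp
    ring
  refine ⟨han, fun n => ?_⟩
  induction n using Nat.strong_induction_on with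
  | _ n ih =>
    rw [heq.iteratedDeriv_eq n,
      iteratedDeriv_add analyticAt_const.contDiffAt (hf.1.mul han).contDiffAt,
      iteratedDeriv_mul hf.1.contDiffAt han.contDiffAt]
    refine add_nonneg ((const zero_le_one).2 n) (Finset.sum_nonneg fun i hi => ?_)
    rcases Nat.eq_zero_or_pos i with rfl | hi0
    · simp [h0]
    · have hin : i < n + 1 := Finset.mem_range.mp hi
      exact mul_nonneg (mul_nonneg (Nat.cast_nonneg _) (hf.2 _)) (ih _ (by omega))

theorem exists_hasFPowerSeriesOnBall (hf : HasNonnegTaylor f) :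
    ∃ (p : FormalMultilinearSeries ℝ ℝ ℝ) (r : ENNReal), 0 < r ∧
      HasFPowerSeriesOnBall f p 0 r ∧ ∀ n : ℕ, 0 ≤ p.coeff n := by
  obtain ⟨r, hr⟩ := hf.1.hasFPowerSeriesAt
  refine ⟨_, r, hr.r_pos, hr, fun n => ?_⟩
  rw [FormalMultilinearSeries.coeff_ofScalars]
  exact div_nonneg (hf.2 n) (Nat.cast_nonneg _)

end HasNonnegTaylor

theorem analyticAt_one_sub_rpow (r : ℝ) : AnalyticAt ℝ (fun x : ℝ => (1 - x) ^ r) 0 := by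
  have hneg : AnalyticAt ℝ (fun x : ℝ => -x) 0 := by fun_prop
  have h := (Real.one_add_rpow_hasFPowerSeriesAt_zero (a := r)).analyticAt.comp_of_eq
    hneg neg_zero
  simpa only [Function.comp_def, ← sub_eq_add_neg] using h

theorem iteratedDeriv_one_sub_rpow (r : ℝ) (n : ℕ) :
    iteratedDeriv n (fun x : ℝ => (1 - x) ^ r) 0 = (ascPochhammer ℝ n).eval (-r) := by
  rw [iteratedDeriv_comp_const_sub (f := fun x : ℝ => x ^ r), iteratedDeriv_eq_iterate,
    ascPochhammer_eval_neg_eq_descPochhammer]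
  simp [Real.iter_deriv_rpow_const]

theorem hasNonnegTaylor_sum_one_sub_rpow {m : ℕ} (c : Fin m → ℝ)
    (h : ∀ n : ℕ, 0 ≤ ∑ i, c i * (ascPochhammer ℝ n).eval (-((i : ℝ) / 2))) :
    HasNonnegTaylor (fun x => ∑ i, c i * (1 - x) ^ ((i : ℝ) / 2)) := by
  have han (i : Fin m) : AnalyticAt ℝ (fun x : ℝ => c i * (1 - x) ^ ((i : ℝ) / 2)) 0 :=
    analyticAt_const.mul (analyticAt_one_sub_rpow _)
  refine ⟨Finset.analyticAt_fun_sum _ fun i _ => han i, fun n => ?_⟩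
  rw [iteratedDeriv_fun_sum fun i _ => (han i).contDiffAt]
  simpa only [iteratedDeriv_const_mul_field, iteratedDeriv_one_sub_rpow] using h n

theorem eventually_rpow_half (m : ℕ) (c : Fin m → ℝ) :
    (fun x : ℝ => ∑ i, c i * (1 - x) ^ ((i : ℝ) / 2)) =ᶠ[𝓝 0]
      fun x => ∑ i, c i * ((1 - x) ^ ((1 : ℝ) / 2)) ^ (i : ℕ) := by
  filter_upwards [Iio_mem_nhds (zero_lt_one' ℝ)] with x hx
  refine Finset.sum_congr rfl fun i _ => ?_
  rw [← Real.rpow_natCast, ← Real.rpow_mul (sub_pos.mpr hx).le]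
  ring_nf

theorem ascPochhammer_eval_succ_left (n : ℕ) (r : ℝ) :
    (ascPochhammer ℝ (n + 1)).eval r = r * (ascPochhammer ℝ n).eval (r + 1) := by
  simp [ascPochhammer_succ_left, Polynomial.eval_comp]

/-- In terms of `s = (1 - x) ^ (1 / 2)`, the polynomial `1 - 3 s² + 2 s³`. -/
theorem hasNonnegTaylor_cubic :
    HasNonnegTaylor (fun x => 1 - 3 * ((1 - x) ^ ((1 : ℝ) / 2)) ^ 2
      + 2 * ((1 - x) ^ ((1 : ℝ) / 2)) ^ 3) := by
  have key := (hasNonnegTaylor_sum_one_sub_rpow (m := 4) ![1, 0, -3, 2] ?_).congr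
    (eventually_rpow_half _ _)
  · convert key using 2 with x
    simp [Fin.sum_univ_succ]
    ring
  intro n
  rcases n with _ | _ | n
  · norm_num [Fin.sum_univ_succ, Fin.succ]
  · norm_num [Fin.sum_univ_succ, Fin.succ]
  · have hpos := ascPochhammer_pos n (1 / 2 : ℝ) (by norm_num)
    simp only [ascPochhammer_eval_succ_left, Fin.sum_univ_succ, Fin.succ]
    norm_num
    rcases n with _ | n
    · norm_num
    · norm_num [ascPochhammer_eval_succ_left] at hpos ⊢
      linarith

/-- In terms of `s = (1 - x) ^ (1 / 2)`, the polynomial `(1 - s) (1 - 2 a (1 - 3 s² + 2 s³))`. -/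
theorem hasNonnegTaylor_quartic {a : ℝ} (ha : a ≤ 1 / 12) :
    HasNonnegTaylor (fun x => (1 - (1 - x) ^ ((1 : ℝ) / 2)) *
      (1 - 2 * (a * (1 - 3 * ((1 - x) ^ ((1 : ℝ) / 2)) ^ 2
        + 2 * ((1 - x) ^ ((1 : ℝ) / 2)) ^ 3)))) := by
  have key := (hasNonnegTaylor_sum_one_sub_rpow (m := 5)
    ![1 - 2 * a, -1 + 2 * a, 6 * a, -10 * a, 4 * a] ?_).congr (eventually_rpow_half _ _)
  · convert key using 2 with x
    simp [Fin.sum_univ_succ]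
    ring
  intro n
  rcases n with _ | _ | _ | n
  · simp [Fin.sum_univ_succ, Fin.succ]
    linarith
  · norm_num [Fin.sum_univ_succ, Fin.succ]
    linarith
  · norm_num [Fin.sum_univ_succ, Fin.succ, ascPochhammer_eval_succ_left]
    linarith
  · have hpos := ascPochhammer_pos (n + 1) (1 / 2 : ℝ) (by norm_num)
    have hhalf : (ascPochhammer ℝ (n + 3)).eval (-(1 / 2) : ℝ) =
        -(1 / 2) * (ascPochhammer ℝ (n + 1)).eval (1 / 2) * (n + 3 / 2) := by
      rw [ascPochhammer_succ_eval, ascPochhammer_eval_succ_left]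
      push_cast
      norm_num
      left
      ring
    have hthree : (ascPochhammer ℝ (n + 3)).eval (-(3 / 2) : ℝ) =
        3 / 4 * (ascPochhammer ℝ (n + 1)).eval (1 / 2) := by
      rw [ascPochhammer_eval_succ_left, ascPochhammer_eval_succ_left]
      norm_num
      ring
    have hzero : (ascPochhammer ℝ (n + 3)).eval (0 : ℝ) = 0 := by
      simp
    have hone : (ascPochhammer ℝ (n + 3)).eval (-1 : ℝ) = 0 := by
      simp [ascPochhammer_eval_succ_left]
    have htwo : (ascPochhammer ℝ (n + 3)).eval (-2 : ℝ) = 0 := by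
      norm_num [ascPochhammer_eval_succ_left]
    have hn : (0 : ℝ) ≤ n := Nat.cast_nonneg n
    norm_num [Fin.sum_univ_succ, Fin.succ, hhalf, hthree, hzero, hone, htwo]
    have hfac : 0 ≤ (n + 3 / 2) * (1 - 2 * a) - 15 * a := by nlinarith
    nlinarith [mul_nonneg hpos.le hfac]

theorem stmt12 (q : ℝ) (hq : q ∈ Set.Ico (12 / 13 : ℝ) 1) :
    ∃ (p : FormalMultilinearSeries ℝ ℝ ℝ) (r : ENNReal), 0 < r ∧
      HasFPowerSeriesOnBall
        (fun x : ℝ =>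
          (1 - (1 - x) ^ ((1 : ℝ) / 2)) /
            (1 - (1 - q) * (1 - 3 * x + 2 * (1 - (1 - x) ^ ((3 : ℝ) / 2)))) ^ 2)
        p 0 r ∧
      ∀ n : ℕ, 0 ≤ p.coeff n := by
  obtain ⟨hq1, hq2⟩ := hq
  have hq0 : 0 < q := by linarith
  set a := (1 - q) / q with ha
  have ha0 : 0 ≤ a := div_nonneg (by linarith) hq0.le
  have ha1 : a ≤ 1 / 12 := by
    rw [ha, div_le_iff₀ hq0]
    linarith
  set u : ℝ → ℝ := fun x => a * (1 - 3 * ((1 - x) ^ ((1 : ℝ) / 2)) ^ 2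
    + 2 * ((1 - x) ^ ((1 : ℝ) / 2)) ^ 3) with hu
  have hu_nonneg : HasNonnegTaylor u := (HasNonnegTaylor.const ha0).mul hasNonnegTaylor_cubic
  have hu0 : u 0 = 0 := by norm_num [hu]
  have hw : HasNonnegTaylor
      ((fun _ => (3 : ℝ)) * (u * u) + (fun _ => (2 : ℝ)) * (u * (u * u))) :=
    ((HasNonnegTaylor.const (by norm_num)).mul (hu_nonneg.mul hu_nonneg)).add
      ((HasNonnegTaylor.const (by norm_num)).mul (hu_nonneg.mul (hu_nonneg.mul hu_nonneg)))
  have hprod := (HasNonnegTaylor.const (inv_nonneg.mpr (sq_nonneg q))).mul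
    ((hasNonnegTaylor_quartic ha1).mul (hw.inv_one_sub (by simp [hu0])))
  refine (hprod.congr ?_).exists_hasFPowerSeriesOnBall
  have hne : ∀ᶠ x in 𝓝 0, 1 - 2 * u x ≠ 0 :=
    (continuousAt_const.sub (continuousAt_const.mul hu_nonneg.1.continuousAt)).eventually_ne
      (by simp [hu0])
  filter_upwards [hne, Iio_mem_nhds (zero_lt_one' ℝ)] with x hx hx1
  have hx0 : 0 ≤ 1 - x := (sub_pos.mpr hx1).le
  have hsq : ((1 - x) ^ ((1 : ℝ) / 2)) ^ 2 = 1 - x := by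
    rw [← Real.rpow_natCast, ← Real.rpow_mul hx0]
    norm_num
  have hcube : (1 - x) ^ ((3 : ℝ) / 2) = ((1 - x) ^ ((1 : ℝ) / 2)) ^ 3 := by
    rw [← Real.rpow_natCast, ← Real.rpow_mul hx0]
    norm_num
  have hden : 1 - (1 - q) * (1 - 3 * x + 2 * (1 - (1 - x) ^ ((3 : ℝ) / 2))) = q * (1 + u x) := by
    have hqa : q * a = 1 - q := by
      rw [ha]
      field_simp
    simp only [hu, hcube, hsq]
    linear_combination (-1 + 3 * (1 - x) - 2 * ((1 - x) ^ ((1 : ℝ) / 2)) ^ 3) * hqa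
  have hfac : 1 - (3 * (u x * u x) + 2 * (u x * (u x * u x))) =
      (1 + u x) ^ 2 * (1 - 2 * u x) := by ring
  rw [hden]
  simp only [Pi.mul_apply, Pi.add_apply, hfac]
  change (q ^ 2)⁻¹ * ((1 - (1 - x) ^ ((1 : ℝ) / 2)) * (1 - 2 * u x) *
    ((1 + u x) ^ 2 * (1 - 2 * u x))⁻¹) = _
  generalize (1 - x) ^ ((1 : ℝ) / 2) = s
  rw [mul_pow, div_eq_mul_inv, mul_inv (q ^ 2), mul_inv ((1 + u x) ^ 2) (1 - 2 * u x)]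
  linear_combination (q ^ 2)⁻¹ * (1 - s) * ((1 + u x) ^ 2)⁻¹ * mul_inv_cancel₀ hx
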